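/- Let ψ be a reduced admissible function and (n_i)_{i≥1} its associated sequence. Then for every element i of S(ψ) with i ≥ 2, one has n_{i+1} > n_i + n_{i−1}. -/

import Mathlib

open Filter

/-- The prefix of length `n` of the infinite word `w`. -/
def pref {A : Type*} (w : ℕ → A) (n : ℕ) : List A := (List.range n).map w

/-- The predicate "the prefix of `w` of length `n` is a palindrome". -/
def palP {A : Type*} (w : ℕ → A) : ℕ → Prop := fun n => (pref w n).Palindrome

/-- An admissible function: index `i : ℕ` stands for the paper's index `i + 1`, and the
value `Sum.inr j` stands for the paper's integer value `j + 1`; so the paper's condition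
`1 ≤ ψ(n) ≤ n - 1` becomes `j < i`. -/
def Admissible {A : Type*} (ψ : ℕ → A ⊕ ℕ) : Prop :=
  ∀ i j, ψ i = Sum.inr j → j < i

/-- The set `S(ψ)` of indices `n` with `ψ(n) ∈ A` or `ψ(n) ≤ n - 2` (in the paper's
indexing; here `i` stands for `n = i + 1` and `Sum.inr j` for the value `j + 1`). -/
def Sset {A : Type*} (ψ : ℕ → A ⊕ ℕ) : Set ℕ :=
  {i | (∃ a, ψ i = Sum.inl a) ∨ ∃ j, ψ i = Sum.inr j ∧ j + 2 ≤ i}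

/-- `m < n` are consecutive elements of `S`. -/
def ConsecIn (S : Set ℕ) (m n : ℕ) : Prop :=
  m ∈ S ∧ n ∈ S ∧ m < n ∧ ∀ k ∈ S, ¬(m < k ∧ k < n)

/-- `ψ` is reduced: for consecutive `m < n` in `S(ψ)`, `ψ(n) ≠ ψ(m)` and either
`ψ(n) ∈ A` or `ψ(n) < m` (in the paper's indexing: `Sum.inr j` stands for the value
`j + 1` and `m` for the index `m + 1`, so the paper's `ψ(n) < m` becomes `j < m`). -/
def Reduced {A : Type*} (ψ : ℕ → A ⊕ ℕ) : Prop :=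
  ∀ m n, ConsecIn (Sset ψ) m n →
    ψ n ≠ ψ m ∧ ((∃ a, ψ n = Sum.inl a) ∨ ∃ j, ψ n = Sum.inr j ∧ j < m)

/-- The palindromes `π_i` associated with `ψ` (`piW ψ i` is the paper's `π_{i+1}`):
`π_1 = ε`; `π_{i+1} = π_i a π_i` if `ψ(i) = a ∈ A`, and `π_{i+1} = π_i u` where `u` is
`π_i` with its first `|π_j|` letters deleted if `ψ(i) = j ∈ ℕ*`. (The `min j i` is
irrelevant when `ψ` is admissible, since then `j < i`.) -/
def piW {A : Type*} (ψ : ℕ → A ⊕ ℕ) : ℕ → List A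
  | 0 => []
  | (i + 1) =>
    match ψ i with
    | Sum.inl a => piW ψ i ++ a :: piW ψ i
    | Sum.inr j => piW ψ i ++ (piW ψ i).drop (piW ψ (min j i)).length

/-- The sequence `(n_i)` associated with `ψ` (`nseq ψ i` is the paper's `n_{i+1}`). -/
def nseq {A : Type*} (ψ : ℕ → A ⊕ ℕ) : ℕ → ℕ
  | 0 => 0
  | (i + 1) =>
    match ψ i with
    | Sum.inl _ => 2 * nseq ψ i + 1
    | Sum.inr j => 2 * nseq ψ i - nseq ψ (min j i)

/-- `δ(ψ) = limsup n_{i+1} / n_i`. -/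
noncomputable def deltaPsi {A : Type*} (ψ : ℕ → A ⊕ ℕ) : ENNReal :=
  limsup (fun i => (nseq ψ (i + 1) : ENNReal) / (nseq ψ i : ENNReal)) atTop

theorem nseq_inl {A : Type*} (ψ : ℕ → A ⊕ ℕ) (i : ℕ) (a : A) (h : ψ i = Sum.inl a) :
    nseq ψ (i + 1) = 2 * nseq ψ i + 1 := by
  simp [nseq, h]

theorem nseq_inr {A : Type*} (ψ : ℕ → A ⊕ ℕ) (hadm : Admissible ψ) (i j : ℕ)
    (h : ψ i = Sum.inr j) : nseq ψ (i + 1) = 2 * nseq ψ i - nseq ψ j := by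
  have := hadm i j h
  simp [nseq, h, min_eq_left this.le]

theorem nseq_lt {A : Type*} (ψ : ℕ → A ⊕ ℕ) (hadm : Admissible ψ) :
    ∀ i, ∀ j < i, nseq ψ j < nseq ψ i := by
  intro i
  induction i with
  | zero => intro j hj; omega
  | succ i ih =>
    have h1 : nseq ψ i < nseq ψ (i + 1) := by
      rcases h : ψ i with a | l
      · rw [nseq_inl ψ i a h]; omega
      · rw [nseq_inr ψ hadm i l h]
        have := ih l (hadm i l h)
        omega
    intro j hj
    rcases Nat.lt_succ_iff_lt_or_eq.mp hj with h | h
    · exact (ih j h).trans h1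
    · rw [h]; exact h1

theorem exists_pred {A : Type*} (ψ : ℕ → A ⊕ ℕ) (hadm : Admissible ψ) (i : ℕ) :
    ∃ m ∈ Sset ψ, m < i + 1 ∧ (∀ k ∈ Sset ψ, ¬(m < k ∧ k < i + 1)) ∧
      nseq ψ (i + 1) + nseq ψ m = nseq ψ (m + 1) + nseq ψ i := by
  induction i with
  | zero =>
    refine ⟨0, ?_, by omega, fun k _ => by omega, rfl⟩
    rcases h : ψ 0 with a | l
    · exact Or.inl ⟨a, h⟩
    · have := hadm 0 l h
      omega
  | succ i ih =>
    by_cases hS : i + 1 ∈ Sset ψ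
    · exact ⟨i + 1, hS, by omega, fun k _ => by omega, rfl⟩
    · obtain ⟨m, hm, hlt, hc, he⟩ := ih
      refine ⟨m, hm, by omega, ?_, ?_⟩
      · intro k hk hh
        by_cases hki : k = i + 1
        · exact hS (hki ▸ hk)
        · exact hc k hk (by omega)
      · rcases h : ψ (i + 1) with a | l
        · exact absurd (Or.inl ⟨a, h⟩) hS
        · have h1 := hadm _ l h
          have h2 : ¬ (l + 2 ≤ i + 1) := fun h2 => hS (Or.inr ⟨l, h, h2⟩)
          have h3 : l = i := by omega
          subst h3
          have h4 := nseq_inr ψ hadm _ _ h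
          have h5 := nseq_lt ψ hadm (l + 1) l (by omega)
          omega

theorem stmt16 {A : Type*} (ψ : ℕ → A ⊕ ℕ) (hadm : Admissible ψ) (hred : Reduced ψ) :
    ∀ i ∈ Sset ψ, 1 ≤ i → nseq ψ i + nseq ψ (i - 1) < nseq ψ (i + 1) := by
  intro i
  induction i using Nat.strong_induction_on with
  | _ i ih =>
  intro hi h1
  have hlt := nseq_lt ψ hadm
  rcases h : ψ i with a | j
  · have := nseq_inl ψ i a h
    have := hlt i (i - 1) (by omega)
    omega
  · have e := nseq_inr ψ hadm i j h
    obtain ⟨i, rfl⟩ : ∃ k, i = k + 1 := ⟨i - 1, by omega⟩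
    obtain ⟨m, hm, hmi, hc, he⟩ := exists_pred ψ hadm i
    obtain ⟨-, hr⟩ := hred m (i + 1) ⟨hm, hi, hmi, hc⟩
    have hjm : j < m := by
      rcases hr with ⟨a, ha⟩ | ⟨j', hj', hh⟩
      · rw [h] at ha; cases ha
      · rw [h] at hj'; cases hj'; exact hh
    have h2 := ih m hmi hm (by omega)
    have h3 : nseq ψ j ≤ nseq ψ (m - 1) := by
      rcases Nat.lt_or_ge j (m - 1) with h' | h'
      · exact (hlt _ _ h').le
      · rw [show j = m - 1 by omega]
    have h4 := hlt (i + 1) j (by omega)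
    simp only [Nat.add_sub_cancel]
    omega
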